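/- Let (J₁, J₂) be a linear generalized Kähler structure on 𝕍 = V × V* with G = −J₁∘J₂, let K ⊆ V* be a subspace satisfying (1) K + J₁(K) ⊆ Ann(K + J₁(K)) and (2) J₁(K) ∩ V* = {0}, and set W_K = Ann(K + J₁(K) + J₂(K) + G(K)) and N = a(J₁(K)). Then the kernel {x ∈ W_K : a(x) ∈ N} of the induced map a_K : W_K → Ann_V(K)/N is an isotropic subspace of W_K for the pairing ⟨,⟩, its dimension equals dim Ann_{V*}(N) − dim K, and dim W_K = 2(dim Ann_V(K) − dim N); in particular the kernel is maximal isotropic in W_K, so the exact sequence 0 → Ann_{V*}(N)/K → W_K → Ann_V(K)/N → 0 is self-dual. (Self-duality part of Lemma kahler:sequence.) -/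

import Mathlib

/-- The generalized tangent space `𝕍 = V × V*`. -/
abbrev GV (V : Type*) [AddCommGroup V] [Module ℝ V] := V × Module.Dual ℝ V

variable (V : Type*) [AddCommGroup V] [Module ℝ V] [FiniteDimensional ℝ V]

/-- The canonical symmetric pairing `⟨(X,ξ),(Y,η)⟩ = (1/2)(η X + ξ Y)` on `𝕍`. -/
noncomputable def pairForm : LinearMap.BilinForm ℝ (GV V) :=
  LinearMap.mk₂ ℝ (fun u v => (1 / 2 : ℝ) * (v.2 u.1 + u.2 v.1))
    (fun u u' v => by simp; ring)
    (fun c u v => by simp; ring)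
    (fun u v v' => by simp; ring)
    (fun c u v => by simp; ring)

/-- `V* = {0} × V*` as a subspace of `𝕍`. -/
def VStar : Submodule ℝ (GV V) := LinearMap.range (LinearMap.inr ℝ V (Module.Dual ℝ V))

variable {V}

/-- The annihilator of a subspace of `𝕍` with respect to the canonical pairing. -/
noncomputable def Ann (S : Submodule ℝ (GV V)) : Submodule ℝ (GV V) where
  carrier := {u : GV V | ∀ s ∈ S, pairForm V u s = 0}
  add_mem' := fun ha hb s hs => by simp [ha s hs, hb s hs]
  zero_mem' := fun s hs => by simp
  smul_mem' := fun c a ha s hs => by simp [ha s hs]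

/-- The image in `𝕍` of a subspace `K ⊆ V*`. -/
def ofDual (K : Submodule ℝ (Module.Dual ℝ V)) : Submodule ℝ (GV V) :=
  K.map (LinearMap.inr ℝ V (Module.Dual ℝ V))

/-- A linear generalized complex structure on `𝕍`. -/
structure IsGenCx (J : GV V →ₗ[ℝ] GV V) : Prop where
  sq : ∀ u, J (J u) = -u
  orth : ∀ u v, pairForm V (J u) (J v) = pairForm V u v

/-- A linear generalized Kähler structure on `𝕍`: two commuting linear generalized
complex structures such that `G = -J₁∘J₂` gives a positive definite form `⟨G·,·⟩`. -/
structure IsGenKahler (J₁ J₂ : GV V →ₗ[ℝ] GV V) : Prop where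
  cx1 : IsGenCx J₁
  cx2 : IsGenCx J₂
  comm : ∀ u, J₁ (J₂ u) = J₂ (J₁ u)
  posdef : ∀ u : GV V, u ≠ 0 → 0 < pairForm V (-(J₁ (J₂ u))) u

section Pairing

variable {V : Type*} [AddCommGroup V] [Module ℝ V]

lemma pairForm_apply (u v : GV V) :
    pairForm V u v = (1 / 2 : ℝ) * (v.2 u.1 + u.2 v.1) := rfl

lemma pairForm_comm (u v : GV V) : pairForm V u v = pairForm V v u := by
  simp only [pairForm_apply]; ring

lemma pairForm_isRefl : (pairForm V).IsRefl := fun u v huv => by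
  rw [pairForm_comm]; exact huv

lemma Ann_eq_orthogonal (S : Submodule ℝ (GV V)) : Ann S = (pairForm V).orthogonal S := by
  ext u
  rw [LinearMap.BilinForm.mem_orthogonal_iff]
  exact forall₂_congr fun s _ => by rw [pairForm_comm]

lemma mem_Ann {S : Submodule ℝ (GV V)} {u : GV V} :
    u ∈ Ann S ↔ ∀ s ∈ S, pairForm V u s = 0 := Iff.rfl

lemma Ann_sup (S T : Submodule ℝ (GV V)) : Ann (S ⊔ T) = Ann S ⊓ Ann T := by
  ext u
  simp only [Submodule.mem_inf, mem_Ann]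
  refine ⟨fun hu => ⟨fun s hs => hu s (Submodule.mem_sup_left hs),
    fun s hs => hu s (Submodule.mem_sup_right hs)⟩, fun hu s hs => ?_⟩
  obtain ⟨a, ha, b, hb, rfl⟩ := Submodule.mem_sup.1 hs
  rw [map_add, hu.1 a ha, hu.2 b hb, add_zero]

lemma mem_VStar {u : GV V} : u ∈ VStar V ↔ u.1 = 0 := by
  constructor
  · rintro ⟨ξ, rfl⟩; rfl
  · intro hu
    exact ⟨u.2, Prod.ext hu.symm rfl⟩

lemma ofDual_le_VStar (K : Submodule ℝ (Module.Dual ℝ V)) : ofDual K ≤ VStar V := by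
  rintro _ ⟨ξ, -, rfl⟩
  exact ⟨ξ, rfl⟩

lemma pairForm_eq_zero_of_mem_VStar {u v : GV V} (hu : u ∈ VStar V) (hv : v ∈ VStar V) :
    pairForm V u v = 0 := by
  rw [mem_VStar] at hu hv
  simp [pairForm_apply, hu, hv]

lemma finrank_ofDual (K : Submodule ℝ (Module.Dual ℝ V)) :
    Module.finrank ℝ (ofDual K) = Module.finrank ℝ K :=
  (Submodule.equivMapOfInjective _ LinearMap.inr_injective K).finrank_eq.symm

lemma IsGenCx.injective {J : GV V →ₗ[ℝ] GV V} (h : IsGenCx J) : Function.Injective J := by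
  intro u v huv
  have := congrArg J huv
  rwa [h.sq, h.sq, neg_inj] at this

lemma comap_map_fst_eq_sup_VStar (L : Submodule ℝ (GV V)) :
    (L.map (LinearMap.fst ℝ V (Module.Dual ℝ V))).comap (LinearMap.fst ℝ V (Module.Dual ℝ V)) =
      L ⊔ VStar V := by
  rw [Submodule.comap_map_eq, VStar, LinearMap.range_inr]

lemma finrank_map_fst {L : Submodule ℝ (GV V)} (hL : L ⊓ VStar V = ⊥) :
    Module.finrank ℝ (L.map (LinearMap.fst ℝ V (Module.Dual ℝ V))) = Module.finrank ℝ L := by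
  have hinj : Function.Injective ((LinearMap.fst ℝ V (Module.Dual ℝ V)).domRestrict L) := by
    refine (injective_iff_map_eq_zero _).2 fun x hx => ?_
    have : (x : GV V) ∈ L ⊓ VStar V := ⟨x.2, mem_VStar.2 hx⟩
    rw [hL] at this
    exact Subtype.ext this
  rw [← LinearMap.finrank_range_of_inj hinj, LinearMap.range_domRestrict]

variable [FiniteDimensional ℝ V]

lemma pairForm_nondegenerate : (pairForm V).Nondegenerate := by
  have key : ∀ u : GV V, (∀ v, pairForm V u v = 0) → u = 0 := by
    intro u hu
    have h2 : u.2 = 0 := by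
      ext X
      simpa [pairForm_apply] using hu (X, 0)
    have h1 : u.1 = 0 := by
      rw [← Module.forall_dual_apply_eq_zero_iff ℝ]
      intro ξ
      simpa [pairForm_apply] using hu (0, ξ)
    exact Prod.ext h1 h2
  exact ⟨key, fun u hu => key u fun v => by rw [pairForm_comm]; exact hu v⟩

lemma Ann_Ann (S : Submodule ℝ (GV V)) : Ann (Ann S) = S := by
  rw [Ann_eq_orthogonal, Ann_eq_orthogonal]
  exact LinearMap.BilinForm.orthogonal_orthogonal pairForm_nondegenerate pairForm_isRefl S

lemma finrank_Ann_add (S : Submodule ℝ (GV V)) :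
    Module.finrank ℝ (Ann S) + Module.finrank ℝ S = 2 * Module.finrank ℝ V := by
  have h1 := LinearMap.BilinForm.finrank_orthogonal pairForm_nondegenerate S
  have h2 := Submodule.finrank_le S
  have h3 : Module.finrank ℝ (GV V) = 2 * Module.finrank ℝ V := by
    rw [Module.finrank_prod, Subspace.dual_finrank_eq, two_mul]
  rw [Ann_eq_orthogonal]
  omega

end Pairing

section PositiveComplement

variable {V : Type*} [AddCommGroup V] [Module ℝ V]
  {G : GV V →ₗ[ℝ] GV V} {B : Submodule ℝ (GV V)}

/-- If `B` is isotropic and `⟨G·,·⟩` is positive definite, then an element of `B + G B`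
orthogonal to `B` lies in `B`. -/
lemma mem_of_mem_sup_map_of_mem_Ann (hpos : ∀ u : GV V, u ≠ 0 → 0 < pairForm V (G u) u)
    (hB : B ≤ Ann B) {s : GV V} (hs : s ∈ B ⊔ B.map G) (hsB : s ∈ Ann B) : s ∈ B := by
  obtain ⟨b, hb, _, ⟨c, hc, rfl⟩, rfl⟩ := Submodule.mem_sup.1 hs
  have h0 : pairForm V (G c) c = 0 := by
    have h1 := hsB c hc
    rwa [map_add, LinearMap.add_apply, hB hb c hc, zero_add] at h1
  have hc0 : c = 0 := by
    by_contra hne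
    exact (hpos c hne).ne' h0
  simpa [hc0] using hb

lemma finrank_sup_map [FiniteDimensional ℝ V]
    (hpos : ∀ u : GV V, u ≠ 0 → 0 < pairForm V (G u) u) (hB : B ≤ Ann B) :
    Module.finrank ℝ ↥(B ⊔ B.map G) = 2 * Module.finrank ℝ B := by
  have hinj : Function.Injective G := by
    rw [← LinearMap.ker_eq_bot, LinearMap.ker_eq_bot']
    intro u hu
    by_contra hne
    simpa [hu] using hpos u hne
  have hdisj : B ⊓ B.map G = ⊥ := by
    rw [eq_bot_iff]
    rintro _ ⟨hb, c, hc, rfl⟩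
    have hc0 : c = 0 := by
      by_contra hne
      exact (hpos c hne).ne' (hB hb c hc)
    simp [hc0]
  have h1 := Submodule.finrank_sup_add_finrank_inf_eq B (B.map G)
  rw [hdisj, finrank_bot, ← (Submodule.equivMapOfInjective G hinj B).finrank_eq] at h1
  omega

end PositiveComplement

/-- self-duality part of Lemma kahler:sequence: the kernel
`{x ∈ W_K : a(x) ∈ N}` of `a_K : W_K → Ann_V(K)/N` is isotropic, its dimension
is `dim Ann_{V*}(N) − dim K`, `dim W_K = 2(dim Ann_V(K) − dim N)`, and the kernel
is maximal isotropic in `W_K`, so the sequence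
`0 → Ann_{V*}(N)/K → W_K → Ann_V(K)/N → 0` is self-dual. -/
theorem statement9 {V : Type*} [AddCommGroup V] [Module ℝ V] [FiniteDimensional ℝ V]
    (J₁ J₂ : GV V →ₗ[ℝ] GV V) (h : IsGenKahler J₁ J₂)
    (K : Submodule ℝ (Module.Dual ℝ V))
    (hK : ofDual K ⊔ (ofDual K).map J₁ ≤ Ann (ofDual K ⊔ (ofDual K).map J₁))
    (hV : (ofDual K).map J₁ ⊓ VStar V = ⊥) :
    let G : GV V →ₗ[ℝ] GV V := -(J₁ ∘ₗ J₂)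
    let Kv : Submodule ℝ (GV V) := ofDual K
    let W : Submodule ℝ (GV V) := Ann (Kv ⊔ Kv.map J₁ ⊔ Kv.map J₂ ⊔ Kv.map G)
    let N : Submodule ℝ V := (Kv.map J₁).map (LinearMap.fst ℝ V (Module.Dual ℝ V))
    let Ker : Submodule ℝ (GV V) := W ⊓ N.comap (LinearMap.fst ℝ V (Module.Dual ℝ V))
    (∀ x ∈ Ker, ∀ y ∈ Ker, pairForm V x y = 0) ∧
    Module.finrank ℝ Ker + Module.finrank ℝ K = Module.finrank ℝ N.dualAnnihilator ∧
    Module.finrank ℝ W + 2 * Module.finrank ℝ N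
      = 2 * Module.finrank ℝ K.dualCoannihilator ∧
    (∀ x ∈ W, (∀ y ∈ Ker, pairForm V x y = 0) → x ∈ Ker) := by
  intro G Kv W N Ker
  set B : Submodule ℝ (GV V) := Kv ⊔ Kv.map J₁ with hBdef
  have hB : B ≤ Ann B := hK
  have hpos : ∀ u : GV V, u ≠ 0 → 0 < pairForm V (G u) u := h.posdef
  have hGJ : (Kv.map J₁).map G = Kv.map J₂ := by
    rw [← Submodule.map_comp]
    congr 1
    refine LinearMap.ext fun u => ?_
    change -(J₁ (J₂ (J₁ u))) = J₂ u
    rw [← h.comm, h.cx1.sq, neg_neg]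
  have hS : Kv ⊔ Kv.map J₁ ⊔ Kv.map J₂ ⊔ Kv.map G = B ⊔ B.map G := by
    rw [hBdef, Submodule.map_sup, hGJ, sup_assoc, sup_comm (Kv.map J₂)]
  have hW : W = Ann (B ⊔ B.map G) := congrArg Ann hS
  have hKV : Kv ≤ VStar V := ofDual_le_VStar K
  have hKB : Kv ≤ B := le_sup_left
  have hJB : Kv.map J₁ ≤ B := le_sup_right
  have hBW : W ≤ Ann B := by
    rw [hW, Ann_sup]
    exact inf_le_left
  have hBV : B ⊓ VStar V ≤ Kv := by
    rintro x ⟨hxB, hxV⟩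
    obtain ⟨κ, hκ, l, hl, rfl⟩ := Submodule.mem_sup.1 hxB
    have hlV : l ∈ Kv.map J₁ ⊓ VStar V :=
      ⟨hl, by simpa using (VStar V).sub_mem hxV (hKV hκ)⟩
    have hl0 : l = 0 := by
      rw [hV] at hlV
      exact hlV
    simpa [hl0] using hκ
  have hcomap : N.comap (LinearMap.fst ℝ V (Module.Dual ℝ V)) = Kv.map J₁ ⊔ VStar V :=
    comap_map_fst_eq_sup_VStar _
  set P : Submodule ℝ (GV V) := Kv.map J₁ ⊔ VStar V with hP
  have hKer : Ker = W ⊓ P := congrArg (W ⊓ ·) hcomap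
  have hAV : Ann P ≤ VStar V := by
    intro x hx
    rw [mem_VStar, ← Module.forall_dual_apply_eq_zero_iff ℝ]
    intro ξ
    simpa [pairForm_apply] using hx (0, ξ) (Submodule.mem_sup_right (mem_VStar.2 rfl))
  have hAB : Ann P ≤ Ann B := by
    intro x hx
    rw [hBdef, Ann_sup]
    exact ⟨fun s hs => hx s (Submodule.mem_sup_right (hKV hs)),
      fun s hs => hx s (Submodule.mem_sup_left hs)⟩
  have hKer' : Ker = Ann (B ⊔ B.map G ⊔ Ann P) := by
    rw [hKer, Ann_sup, Ann_Ann, hW]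
  have hinf : (B ⊔ B.map G) ⊓ Ann P = Kv := by
    refine le_antisymm ?_ ?_
    · rintro x ⟨hxS, hxA⟩
      exact hBV ⟨mem_of_mem_sup_map_of_mem_Ann hpos hB hxS (hAB hxA), hAV hxA⟩
    · refine le_inf (hKB.trans le_sup_left) ?_
      rw [hP, Ann_sup]
      exact fun x hx => ⟨fun s hs => hB (hKB hx) s (hJB hs),
        fun s hs => pairForm_eq_zero_of_mem_VStar (hKV hx) hs⟩
  have dK : Module.finrank ℝ Kv = Module.finrank ℝ K := finrank_ofDual K
  have dJK : Module.finrank ℝ (Kv.map J₁) = Module.finrank ℝ K := by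
    rw [← (Submodule.equivMapOfInjective J₁ h.cx1.injective Kv).finrank_eq, dK]
  have dB : Module.finrank ℝ B = 2 * Module.finrank ℝ K := by
    have h1 := Submodule.finrank_sup_add_finrank_inf_eq Kv (Kv.map J₁)
    have h2 : Kv ⊓ Kv.map J₁ = ⊥ :=
      eq_bot_iff.2 ((le_inf inf_le_right (inf_le_left.trans hKV)).trans hV.le)
    rw [h2, finrank_bot, dK, dJK] at h1
    rw [hBdef]
    omega
  have dS := finrank_sup_map hpos hB
  have dN : Module.finrank ℝ N = Module.finrank ℝ K := (finrank_map_fst hV).trans dJK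
  have dVs : Module.finrank ℝ (VStar V) = Module.finrank ℝ V := by
    rw [VStar, LinearMap.finrank_range_of_inj LinearMap.inr_injective, Subspace.dual_finrank_eq]
  have dP : Module.finrank ℝ P = Module.finrank ℝ K + Module.finrank ℝ V := by
    have h1 := Submodule.finrank_sup_add_finrank_inf_eq (Kv.map J₁) (VStar V)
    rwa [hV, finrank_bot, dJK, dVs, add_zero] at h1
  have dA := finrank_Ann_add P
  have dW := finrank_Ann_add (B ⊔ B.map G)
  rw [← hW] at dW
  have dKer := finrank_Ann_add (B ⊔ B.map G ⊔ Ann P)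
  rw [← hKer'] at dKer
  have dSA := Submodule.finrank_sup_add_finrank_inf_eq (B ⊔ B.map G) (Ann P)
  rw [hinf] at dSA
  have dNa := Subspace.finrank_add_finrank_dualAnnihilator_eq N
  have dKc := Subspace.finrank_add_finrank_dualCoannihilator_eq K
  refine ⟨fun x hx y hy => ?_, by omega, by omega, fun x hx hxy => ?_⟩
  · rw [hKer] at hx hy
    obtain ⟨l, hl, ξ, hξ, rfl⟩ := Submodule.mem_sup.1 hx.2
    obtain ⟨m, hm, η, hη, rfl⟩ := Submodule.mem_sup.1 hy.2
    have h1 := hBW hx.1 m (hJB hm)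
    have h2 := hBW hy.1 l (hJB hl)
    have h3 := hB (hJB hl) m (hJB hm)
    have h4 := pairForm_eq_zero_of_mem_VStar hξ hη
    rw [pairForm_comm] at h2
    simp only [map_add, LinearMap.add_apply] at h1 h2 ⊢
    linarith
  · have hx' : x ∈ Ann Ker := hxy
    rw [hKer', Ann_Ann] at hx'
    obtain ⟨s, hs, α, hα, rfl⟩ := Submodule.mem_sup.1 hx'
    have hsB : s ∈ B := mem_of_mem_sup_map_of_mem_Ann hpos hB hs
      (by simpa using (Ann B).sub_mem (hBW hx) (hAB hα))
    have hBP : B ≤ P := sup_le (hKV.trans le_sup_right) le_sup_left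
    rw [hKer]
    exact ⟨hx, P.add_mem (hBP hsB) (Submodule.mem_sup_right (hAV hα))⟩
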